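/- In the golf model on Z/nZ with parameters n, n_b, n_t, p, assume K := n_t − n_b > 0. Let X ⊆ Z/nZ with |X| = K, write ℓ_i = Δ_i X, and let (b_i)_{i∈Z/KZ} be nonnegative integers with Σ_i b_i = n_b and 2b_i ≤ ℓ_i for every i. Then, conditionally on the event that X ⊆ T⁰ and that for each i the block B_i of X contains exactly b_i balls and exactly b_i holes of the initial configuration, one has P(TL = X | this event) = Π_{i∈Z/KZ} 1/(b_i + 1). -/

import Mathlib

open Finset MeasureTheory Filter Asymptotics
open scoped Classical

namespace Golf

/-- Canonical position of a vertex of the cycle `Z/nZ` in `{1, …, n}`. -/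
def cpos {n : ℕ} (v : Fin n) : ℕ := if v.val = 0 then n else v.val

/-- Shift a vertex by `d` steps in the positive direction. -/
def shiftR {n : ℕ} (v : Fin n) (d : ℕ) : Fin n :=
  ⟨(v.val + d) % n, Nat.mod_lt _ (Nat.lt_of_le_of_lt (Nat.zero_le _) v.isLt)⟩

/-- Shift a vertex by `d` steps in the negative direction. -/
def shiftL {n : ℕ} (v : Fin n) (d : ℕ) : Fin n := shiftR v (n - d % n)

/-- Distance (in `[1, n]`) from `v` to the nearest element of `H` in the positive direction. -/
def distR {n : ℕ} (H : Finset (Fin n)) (v : Fin n) : ℕ :=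
  if h : ((Finset.Icc 1 n).filter fun d => shiftR v d ∈ H).Nonempty then
    ((Finset.Icc 1 n).filter fun d => shiftR v d ∈ H).min' h
  else 0

/-- Distance (in `[1, n]`) from `v` to the nearest element of `H` in the negative direction. -/
def distL {n : ℕ} (H : Finset (Fin n)) (v : Fin n) : ℕ :=
  if h : ((Finset.Icc 1 n).filter fun d => shiftL v d ∈ H).Nonempty then
    ((Finset.Icc 1 n).filter fun d => shiftL v d ∈ H).min' h
  else 0

/-- Probability that the ball activated at `v` fills the nearest free hole in the positive
direction, when the current set of free holes is `H`, for the `p`-biased random walk. -/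
noncomputable def rightProb {n : ℕ} (p : ℝ) (H : Finset (Fin n)) (v : Fin n) : ℝ :=
  if p = 1 / 2 then (distL H v : ℝ) / ((distL H v : ℝ) + (distR H v : ℝ))
  else (1 - ((1 - p) / p) ^ distL H v) / (1 - ((1 - p) / p) ^ (distL H v + distR H v))

/-- New set of free holes after the ball at `v` makes its choice
(`true` = fill the nearest free hole in the positive direction). -/
def golfStep {n : ℕ} (H : Finset (Fin n)) (v : Fin n) (choice : Bool) : Finset (Fin n) :=
  if choice then H.erase (shiftR v (distR H v)) else H.erase (shiftL v (distL H v))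

/-- Final set of free holes after activating the listed balls with the listed choices. -/
def golfRun {n : ℕ} : List (Fin n) → List Bool → Finset (Fin n) → Finset (Fin n)
  | v :: vs, c :: cs, H => golfRun vs cs (golfStep H v c)
  | _, _, H => H

/-- Probability of a given sequence of left/right choices. -/
noncomputable def golfWeight {n : ℕ} (p : ℝ) :
    List (Fin n) → List Bool → Finset (Fin n) → ℝ
  | v :: vs, c :: cs, H =>
      (if c then rightProb p H v else 1 - rightProb p H v) * golfWeight p vs cs (golfStep H v c)
  | _, _, _ => 1

/-- Initial data of the golf model: an initial configuration with `nb` balls (listed in their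
activation order, encoded as an embedding `Fin nb ↪ Fin n`) and `nt` holes, the balls and holes
being on distinct vertices.  The initial configuration together with the activation order is
uniform on this set. -/
noncomputable def golfInit (n nb nt : ℕ) : Finset ((Fin nb ↪ Fin n) × Finset (Fin n)) :=
  Finset.univ.filter fun fT => fT.2.card = nt ∧ ∀ i, fT.1 i ∉ fT.2

/-- Expectation of `g B⁰ T⁰ TL` in the golf model on `Z/nZ` with `nb` balls, `nt` holes and
walk parameter `p`, where `B⁰` is the initial set of balls, `T⁰` the initial set of holes and
`TL` the final set of free holes. -/
noncomputable def golfExp (n nb nt : ℕ) (p : ℝ)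
    (g : Finset (Fin n) → Finset (Fin n) → Finset (Fin n) → ℝ) : ℝ :=
  (∑ fT ∈ golfInit n nb nt, ∑ cs : Fin nb → Bool,
      golfWeight p (List.ofFn ⇑fT.1) (List.ofFn cs) fT.2 *
        g (Finset.univ.map fT.1) fT.2 (golfRun (List.ofFn ⇑fT.1) (List.ofFn cs) fT.2)) /
    (golfInit n nb nt).card

/-- `golfProb n nb nt p X` is the probability that the final set of free holes is `X`. -/
noncomputable def golfProb (n nb nt : ℕ) (p : ℝ) (X : Finset (Fin n)) : ℝ :=
  golfExp n nb nt p fun _ _ TL => if TL = X then 1 else 0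

/-- Sorted list of the canonical positions of the elements of `X`. -/
def sortedPos {n : ℕ} (X : Finset (Fin n)) : List ℕ := (X.image cpos).sort (· ≤ ·)

/-- `blockSize X i` is the size `Δ_i X` of the `i`-th block of `X`. -/
def blockSize {n : ℕ} (X : Finset (Fin n)) (i : ℕ) : ℕ :=
  let q := sortedPos X
  let k := q.length
  (q.getD (i % k) 0 + n - q.getD ((i + k - 1) % k) 0 - 1) % n

/-- `blockSet X i` is the `i`-th block `B_i` of `X`: the set of vertices strictly between
`x_i` and `x_{i+1}` in the positive direction. -/
def blockSet {n : ℕ} (X : Finset (Fin n)) (i : ℕ) : Finset (Fin n) :=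
  let q := sortedPos X
  let k := q.length
  let lo := q.getD ((i + k - 1) % k) 0
  let hi := q.getD (i % k) 0
  Finset.univ.filter fun v =>
    if lo < hi then lo < cpos v ∧ cpos v < hi else cpos v < hi ∨ lo < cpos v

/-- Size of the largest block of `X`. -/
def maxBlockSize {n : ℕ} (X : Finset (Fin n)) : ℕ :=
  (Finset.range X.card).sup (blockSize X)

/-- `multinom3 a b c` is the multinomial coefficient `(a+b+c)! / (a! b! c!)`. -/
def multinom3 (a b c : ℕ) : ℕ :=
  (a + b + c).factorial / (a.factorial * b.factorial * c.factorial)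

end Golf

open Golf

namespace Golf

section Generic

variable {V : Type*}

/-- Expectation of `φ` at the final hole set when the listed balls are activated, the ball at `v`
choosing `true` with probability `π H v`, and `st` giving the new set of free holes. -/
noncomputable def runExp (π : Finset V → V → ℝ) (st : Finset V → V → Bool → Finset V)
    (φ : Finset V → ℝ) : List V → Finset V → ℝ
  | [], H => φ H
  | v :: vs, H =>
      π H v * runExp π st φ vs (st H v true) + (1 - π H v) * runExp π st φ vs (st H v false)

theorem runExp_const (π : Finset V → V → ℝ) (st : Finset V → V → Bool → Finset V) (a : ℝ)
    (l : List V) (H : Finset V) : runExp π st (fun _ => a) l H = a := by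
  induction l generalizing H with
  | nil => rfl
  | cons v vs ih => simp only [runExp, ih]; ring

theorem runExp_sum {ι : Type*} (s : Finset ι) (π : Finset V → V → ℝ)
    (st : Finset V → V → Bool → Finset V) (φ : ι → Finset V → ℝ) (l : List V) (H : Finset V) :
    runExp π st (fun T => ∑ i ∈ s, φ i T) l H = ∑ i ∈ s, runExp π st (φ i) l H := by
  induction l generalizing H with
  | nil => rfl
  | cons v vs ih => simp only [runExp, ih, Finset.mul_sum, Finset.sum_add_distrib]

/-- The value of `runExp` only depends on `φ` at the sets reached from `(l, H)`. -/
theorem runExp_congr_of_invariant (π : Finset V → V → ℝ) (st : Finset V → V → Bool → Finset V)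
    (P : List V → Finset V → Prop) (hP : ∀ v vs H c, P (v :: vs) H → P vs (st H v c))
    {φ ψ : Finset V → ℝ} (hφ : ∀ H, P [] H → φ H = ψ H) (l : List V) (H : Finset V)
    (h : P l H) : runExp π st φ l H = runExp π st ψ l H := by
  induction l generalizing H with
  | nil => exact hφ H h
  | cons v vs ih =>
    simp only [runExp]
    rw [ih _ (hP v vs H true h), ih _ (hP v vs H false h)]

theorem runExp_eq_zero [DecidableEq V] (π : Finset V → V → ℝ)
    (st : Finset V → V → Bool → Finset V) (hst : ∀ H v c, st H v c ⊆ H) (X : Finset V)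
    (l : List V) (H : Finset V) (h : ¬ X ⊆ H) :
    runExp π st (fun T => if T = X then 1 else 0) l H = 0 := by
  refine (runExp_congr_of_invariant π st (fun _ H => ¬ X ⊆ H) ?_ ?_ l H h).trans
    (runExp_const π st 0 l H)
  · exact fun v vs H c hH h' => hH (h'.trans (hst H v c))
  · intro H hH
    rw [if_neg]
    rintro rfl
    exact hH subset_rfl

/-- Two dynamics which agree until they leave the supersets of `X` have the same probability of
terminating at `X`. -/
theorem runExp_coupling [DecidableEq V] (π π' : Finset V → V → ℝ)
    (st st' : Finset V → V → Bool → Finset V)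
    (hst : ∀ H v c, st H v c ⊆ H) (hst' : ∀ H v c, st' H v c ⊆ H) (X : Finset V)
    (hπ : ∀ H v, X ⊆ H → v ∉ H → π H v = π' H v)
    (hs : ∀ H v c, X ⊆ H → v ∉ H →
      st H v c = st' H v c ∨ (¬ X ⊆ st H v c ∧ ¬ X ⊆ st' H v c))
    (l : List V) (H : Finset V) (hl : ∀ v ∈ l, v ∉ H) :
    runExp π st (fun T => if T = X then 1 else 0) l H =
      runExp π' st' (fun T => if T = X then 1 else 0) l H := by
  induction l generalizing H with
  | nil => rfl
  | cons v vs ih =>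
    by_cases hX : X ⊆ H
    · have hv : v ∉ H := hl v (by simp)
      have key : ∀ c, runExp π st (fun T => if T = X then 1 else 0) vs (st H v c) =
          runExp π' st' (fun T => if T = X then 1 else 0) vs (st' H v c) := by
        intro c
        rcases hs H v c hX hv with h | ⟨h, h'⟩
        · rw [← h]
          exact ih _ fun w hw hw' => hl w (by simp [hw]) (hst _ _ _ hw')
        · rw [runExp_eq_zero π st hst X _ _ h, runExp_eq_zero π' st' hst' X _ _ h']
      simp only [runExp, key, hπ H v hX hv]
    · rw [runExp_eq_zero π st hst X _ _ hX, runExp_eq_zero π' st' hst' X _ _ hX]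

theorem runExp_map [DecidableEq V] (π : Finset V → V → ℝ) (st : Finset V → V → Bool → Finset V)
    (g : Equiv.Perm V) (hπ : ∀ H v, π (H.map g.toEmbedding) (g v) = π H v)
    (hst : ∀ H v c, st (H.map g.toEmbedding) (g v) c = (st H v c).map g.toEmbedding)
    (φ : Finset V → ℝ) (l : List V) (H : Finset V) :
    runExp π st φ (l.map g) (H.map g.toEmbedding) =
      runExp π st (fun T => φ (T.map g.toEmbedding)) l H := by
  induction l generalizing H with
  | nil => rfl
  | cons v vs ih => simp only [List.map_cons, runExp, hπ, hst, ih]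

/-- Probability that the walk started at distance `a` from the left barrier and `c` from the right
barrier exits through the right one. -/
noncomputable def exitProb (p : ℝ) (a c : ℕ) : ℝ :=
  if p = 1 / 2 then (a : ℝ) / ((a : ℝ) + (c : ℝ))
  else (1 - ((1 - p) / p) ^ a) / (1 - ((1 - p) / p) ^ (a + c))

/-- First positive time at which the `s`-orbit of `v` meets `H`. -/
noncomputable def hitTime (s : Equiv.Perm V) (H : Finset V) (v : V) : ℕ :=
  sInf {d | 1 ≤ d ∧ (s ^ d) v ∈ H}

theorem hitTime_spec {s : Equiv.Perm V} {H : Finset V} {v : V}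
    (h : ∃ d, 1 ≤ d ∧ (s ^ d) v ∈ H) :
    1 ≤ hitTime s H v ∧ (s ^ hitTime s H v) v ∈ H ∧
      ∀ d, 1 ≤ d → d < hitTime s H v → (s ^ d) v ∉ H := by
  have h1 : hitTime s H v ∈ {d | 1 ≤ d ∧ (s ^ d) v ∈ H} := Nat.sInf_mem h
  exact ⟨h1.1, h1.2, fun d hd hlt hm => Nat.notMem_of_lt_sInf hlt ⟨hd, hm⟩⟩

theorem hitTime_eq {s : Equiv.Perm V} {H : Finset V} {v : V} {c : ℕ} (hc : 1 ≤ c)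
    (hm : (s ^ c) v ∈ H) (hlt : ∀ d, 1 ≤ d → d < c → (s ^ d) v ∉ H) : hitTime s H v = c := by
  obtain ⟨h1, h2, h3⟩ := hitTime_spec ⟨c, hc, hm⟩
  rcases lt_trichotomy (hitTime s H v) c with h | h | h
  · exact absurd h2 (hlt _ h1 h)
  · exact h
  · exact absurd hm (h3 _ hc h)

theorem hitTime_map {s g : Equiv.Perm V} (hg : Commute g s) (H : Finset V) (v : V) :
    hitTime s (H.map g.toEmbedding) (g v) = hitTime s H v := by
  have h : ∀ d : ℕ, (s ^ d) (g v) = g ((s ^ d) v) := fun d => by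
    rw [← Equiv.Perm.mul_apply, ← Equiv.Perm.mul_apply, (hg.pow_right d).eq]
  simp [hitTime, h]

/-- Right-exit probability for the golf dynamics whose successor map is `s`. -/
noncomputable def permProb (p : ℝ) (s : Equiv.Perm V) (H : Finset V) (v : V) : ℝ :=
  exitProb p (hitTime s⁻¹ H v) (hitTime s H v)

/-- One step of the golf dynamics whose successor map is `s`. -/
noncomputable def permStep [DecidableEq V] (s : Equiv.Perm V) (H : Finset V) (v : V) (c : Bool) :
    Finset V :=
  if c then H.erase ((s ^ hitTime s H v) v) else H.erase ((s⁻¹ ^ hitTime s⁻¹ H v) v)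

theorem permStep_subset [DecidableEq V] (s : Equiv.Perm V) (H : Finset V) (v : V) (c : Bool) :
    permStep s H v c ⊆ H := by
  unfold permStep
  split_ifs <;> exact Finset.erase_subset _ _

theorem permProb_map {s g : Equiv.Perm V} (hg : Commute g s) (p : ℝ) (H : Finset V) (v : V) :
    permProb p s (H.map g.toEmbedding) (g v) = permProb p s H v := by
  rw [permProb, hitTime_map hg, hitTime_map hg.inv_right, permProb]

theorem permStep_map [DecidableEq V] {s g : Equiv.Perm V} (hg : Commute g s) (H : Finset V) (v : V)
    (c : Bool) :
    permStep s (H.map g.toEmbedding) (g v) c = (permStep s H v c).map g.toEmbedding := by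
  have h : ∀ (t : Equiv.Perm V), Commute g t → ∀ d : ℕ, (t ^ d) (g v) = g.toEmbedding ((t ^ d) v) :=
    fun t ht d => by
      rw [Equiv.coe_toEmbedding, ← Equiv.Perm.mul_apply, ← Equiv.Perm.mul_apply,
        (ht.pow_right d).eq]
  unfold permStep
  rw [hitTime_map hg, hitTime_map hg.inv_right, h s hg, h s⁻¹ hg.inv_right]
  split_ifs <;> rw [Finset.map_erase]

end Generic

section Cycles

variable {V ι : Type*} [Fintype V] [DecidableEq V] [Fintype ι] [DecidableEq ι]

omit [DecidableEq V] in
theorem exists_pow_of_sameCycle {s : Equiv.Perm V} {v w : V} (h : s.SameCycle v w) :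
    ∃ d, 1 ≤ d ∧ (s ^ d) v = w := by
  obtain ⟨d, hd, -, h⟩ := h.exists_pow_eq''
  exact ⟨d, hd, h⟩

theorem permStep_spec (s : Equiv.Perm V) (H : Finset V) (v : V) (c : Bool)
    (h : ∃ w ∈ H, s.SameCycle v w) :
    ∃ w ∈ H, s.SameCycle v w ∧ permStep s H v c = H.erase w := by
  obtain ⟨w, hw, hvw⟩ := h
  cases c with
  | true =>
    obtain ⟨d, hd, hd'⟩ := exists_pow_of_sameCycle hvw
    obtain ⟨-, h2, -⟩ := hitTime_spec (s := s) (H := H) (v := v) ⟨d, hd, hd' ▸ hw⟩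
    exact ⟨_, h2, ⟨_, by rw [zpow_natCast]⟩, by simp [permStep]⟩
  | false =>
    obtain ⟨d, hd, hd'⟩ := exists_pow_of_sameCycle (s := s⁻¹) (Equiv.Perm.sameCycle_inv.2 hvw)
    obtain ⟨-, h2, -⟩ := hitTime_spec (s := s⁻¹) (H := H) (v := v) ⟨d, hd, hd' ▸ hw⟩
    exact ⟨_, h2, Equiv.Perm.sameCycle_inv.1 ⟨_, by rw [zpow_natCast]⟩, by simp [permStep]⟩

/-- Each cycle, labelled by `idx`, has one more free hole than it has balls still to play. -/
def OneExcess (idx : V → ι) (l : List V) (H : Finset V) : Prop :=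
  ∀ j, (H.filter fun v => idx v = j).card = l.countP (fun v => idx v = j) + 1

omit [Fintype ι] in
theorem OneExcess.step {s : Equiv.Perm V} {idx : V → ι}
    (hs : ∀ v w, idx v = idx w ↔ s.SameCycle v w) {v : V} {vs : List V} {H : Finset V}
    (h : OneExcess idx (v :: vs) H) (c : Bool) : OneExcess idx vs (permStep s H v c) := by
  have hne : (H.filter fun w => idx w = idx v).Nonempty := by
    rw [← Finset.card_pos, h]; omega
  obtain ⟨w, hw⟩ := hne
  rw [Finset.mem_filter] at hw
  obtain ⟨u, hu, hvu, he⟩ := permStep_spec s H v c ⟨w, hw.1, (hs v w).1 hw.2.symm⟩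
  have huv : idx u = idx v := ((hs v u).2 hvu).symm
  intro j
  have hj := h j
  rw [List.countP_cons] at hj
  rw [he, Finset.filter_erase]
  by_cases hvj : idx v = j
  · rw [Finset.card_erase_of_mem (by simp [hu, huv, hvj]), hj]
    simp [hvj]
  · rw [Finset.erase_eq_of_notMem (by simp [huv, hvj]), hj]
    simp [hvj]

theorem OneExcess.sum_sections {idx : V → ι} {H : Finset V} (h : OneExcess idx [] H) :
    (∑ y ∈ Fintype.piFinset (fun j => univ.filter fun v => idx v = j),
      if H = univ.image y then (1 : ℝ) else 0) = 1 := by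
  have h' : ∀ j, ∃ v, (H.filter fun v => idx v = j) = {v} := fun j =>
    Finset.card_eq_one.1 (by simpa using h j)
  choose y hy using h'
  have hy' : ∀ j v, (v ∈ H ∧ idx v = j) ↔ v = y j := fun j v => by
    simpa using Finset.ext_iff.1 (hy j) v
  rw [Finset.sum_eq_single y]
  · rw [if_pos]
    ext v
    simp only [Finset.mem_image, Finset.mem_univ, true_and]
    constructor
    · intro hv
      exact ⟨idx v, ((hy' _ v).1 ⟨hv, rfl⟩).symm⟩
    · rintro ⟨j, rfl⟩
      exact ((hy' j _).2 rfl).1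
  · intro z hz hzy
    rw [if_neg]
    rintro rfl
    apply hzy
    funext j
    simp only [Fintype.mem_piFinset, Finset.mem_filter, Finset.mem_univ, true_and] at hz
    exact (hy' j (z j)).1 ⟨by simp, hz j⟩
  · intro hy2
    exact absurd (by simpa using fun j => ((hy' j _).2 rfl).2) hy2

/-- Initial data with `b j` balls and `b j + 1` holes in the cycle labelled `j`. -/
noncomputable def cycleInit (idx : V → ι) (m : ℕ) (b : ι → ℕ) : Finset ((Fin m ↪ V) × Finset V) :=
  univ.filter fun fT => (∀ i, fT.1 i ∉ fT.2) ∧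
    (∀ j, (univ.filter fun i => idx (fT.1 i) = j).card = b j) ∧
    ∀ j, (fT.2.filter fun v => idx v = j).card = b j + 1

omit [Fintype V] [DecidableEq V] [Fintype ι] in
theorem countP_ofFn (idx : V → ι) {m : ℕ} (f : Fin m → V) (j : ι) :
    (List.ofFn f).countP (fun v => idx v = j) = (univ.filter fun i => idx (f i) = j).card := by
  induction m with
  | zero => simp
  | succ m ih =>
    rw [List.ofFn_succ, List.countP_cons, ih, Fin.card_filter_univ_succ]
    by_cases h : idx (f 0) = j <;> simp [h]

theorem oneExcess_of_mem_cycleInit {idx : V → ι} {m : ℕ} {b : ι → ℕ}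
    {fT : (Fin m ↪ V) × Finset V} (h : fT ∈ cycleInit idx m b) :
    OneExcess idx (List.ofFn fT.1) fT.2 := by
  intro j
  simp only [cycleInit, Finset.mem_filter, Finset.mem_univ, true_and] at h
  rw [h.2.2 j, ← h.2.1 j, countP_ofFn]

/-- A permutation acts on initial data. -/
noncomputable def initPerm (g : Equiv.Perm V) (m : ℕ) : Equiv.Perm ((Fin m ↪ V) × Finset V) :=
  Equiv.prodCongr ((Equiv.refl (Fin m)).embeddingCongr g) g.finsetCongr

theorem initPerm_mem_cycleInit {idx : V → ι} {m : ℕ} {b : ι → ℕ} {g : Equiv.Perm V}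
    (hg : ∀ v, idx (g v) = idx v) (fT : (Fin m ↪ V) × Finset V) :
    fT ∈ cycleInit idx m b ↔ initPerm g m fT ∈ cycleInit idx m b := by
  simp [cycleInit, initPerm, Finset.filter_map, hg]

omit [Fintype V] [DecidableEq V] [Fintype ι] [DecidableEq ι] in
theorem exists_commute_perm {s : Equiv.Perm V} {idx : V → ι}
    (hs : ∀ v w, idx v = idx w ↔ s.SameCycle v w) {x y : ι → V} (hx : ∀ j, idx (x j) = j)
    (hy : ∀ j, idx (y j) = j) :
    ∃ g : Equiv.Perm V, Commute g s ∧ (∀ v, idx (g v) = idx v) ∧ ∀ j, g (x j) = y j := by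
  have h : ∀ j, ∃ k : ℤ, (s ^ k) (x j) = y j := fun j =>
    (hs (x j) (y j)).1 ((hx j).trans (hy j).symm)
  choose k hk using h
  have hz : ∀ (z : ℤ) v, idx ((s ^ z) v) = idx v := fun z v =>
    (((hs v _).2 ⟨z, rfl⟩)).symm
  refine ⟨⟨fun v => (s ^ k (idx v)) v, fun v => (s ^ (-k (idx v))) v, ?_, ?_⟩, ?_, ?_, ?_⟩
  · intro v; simp [hz]
  · intro v
    have := hz (-k (idx v)) v
    simp only [this]
    simp
  · ext v
    have := hz 1 v
    rw [zpow_one] at this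
    simp only [Equiv.Perm.mul_apply, Equiv.coe_fn_mk, this]
    rw [← Equiv.Perm.mul_apply, ← Equiv.Perm.mul_apply, (Commute.refl s).zpow_left _ |>.eq]
  · intro v; simp [hz]
  · intro j; simp [hx, hk]

/-- For the golf dynamics on a union of cycles, each with one hole in excess, the final hole set is
uniform among all transversals of the cycles. -/
theorem cycle_golf (p : ℝ) (s : Equiv.Perm V) (idx : V → ι)
    (hs : ∀ v w, idx v = idx w ↔ s.SameCycle v w) (x : ι → V) (hx : ∀ j, idx (x j) = j)
    (m : ℕ) (b : ι → ℕ) :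
    (∑ fT ∈ cycleInit idx m b,
      runExp (permProb p s) (permStep s) (fun T => if T = univ.image x then 1 else 0)
        (List.ofFn fT.1) fT.2) * ∏ j, ((b j : ℝ) + 1) =
      ((cycleInit idx m b).filter fun fT => univ.image x ⊆ fT.2).card := by
  set S : Finset (ι → V) := Fintype.piFinset (fun j => univ.filter fun v => idx v = j) with hS
  have hmem : ∀ y, y ∈ S ↔ ∀ j, idx (y j) = j := by simp [hS]
  set W : (ι → V) → ℝ := fun y => ∑ fT ∈ cycleInit idx m b,
      runExp (permProb p s) (permStep s) (fun T => if T = univ.image y then 1 else 0)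
        (List.ofFn fT.1) fT.2 with hW
  set N : (ι → V) → ℝ := fun y =>
    ∑ fT ∈ cycleInit idx m b, if univ.image y ⊆ fT.2 then (1 : ℝ) else 0 with hN
  have himg : ∀ (g : Equiv.Perm V) (y : ι → V), (∀ j, g (x j) = y j) →
      univ.image y = (univ.image x).map g.toEmbedding := by
    intro g y h
    rw [Finset.map_eq_image, Finset.image_image]
    congr 1
    funext j
    exact (h j).symm
  have hWy : ∀ y ∈ S, W y = W x := by
    intro y hy
    obtain ⟨g, hg, hgi, hgx⟩ := exists_commute_perm hs hx ((hmem y).1 hy)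
    symm
    refine Finset.sum_equiv (initPerm g m) (fun fT => initPerm_mem_cycleInit hgi fT) ?_
    intro fT _
    have h1 : List.ofFn (initPerm g m fT).1 = (List.ofFn fT.1).map g := by
      rw [List.map_ofFn]; rfl
    have h2 : (initPerm g m fT).2 = fT.2.map g.toEmbedding := rfl
    rw [h1, h2, runExp_map _ _ g (permProb_map hg p) (permStep_map hg)]
    simp only [himg g y hgx, Finset.map_inj]
  have hNy : ∀ y ∈ S, N y = N x := by
    intro y hy
    obtain ⟨g, hg, hgi, hgx⟩ := exists_commute_perm hs hx ((hmem y).1 hy)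
    symm
    refine Finset.sum_equiv (initPerm g m) (fun fT => initPerm_mem_cycleInit hgi fT) ?_
    intro fT _
    have h2 : (initPerm g m fT).2 = fT.2.map g.toEmbedding := rfl
    simp only [h2, himg g y hgx, Finset.map_subset_map]
  have hWs : ∑ y ∈ S, W y = (cycleInit idx m b).card := by
    simp only [hW]
    rw [Finset.sum_comm, Finset.card_eq_sum_ones, Nat.cast_sum]
    refine Finset.sum_congr rfl fun fT hfT => ?_
    rw [← runExp_sum, Nat.cast_one]
    exact (runExp_congr_of_invariant _ _ (OneExcess idx) (fun v vs H c h => h.step hs c)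
      (fun H h => h.sum_sections) _ _ (oneExcess_of_mem_cycleInit hfT)).trans
      (runExp_const (permProb p s) (permStep s) 1 (List.ofFn fT.1) fT.2)
  have hNs : ∑ y ∈ S, N y = (cycleInit idx m b).card * ∏ j, ((b j : ℝ) + 1) := by
    simp only [hN]
    rw [Finset.sum_comm, ← nsmul_eq_mul, ← Finset.sum_const]
    refine Finset.sum_congr rfl fun fT hfT => ?_
    simp only [cycleInit, Finset.mem_filter, Finset.mem_univ, true_and] at hfT
    have : ∏ j, ((b j : ℝ) + 1) =
        ((Fintype.piFinset fun j => fT.2.filter fun v => idx v = j).card : ℝ) := by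
      rw [Fintype.card_piFinset]
      simp [hfT.2.2]
    rw [this, Finset.sum_boole]
    congr 2
    ext y
    simp only [Finset.mem_filter, hmem, Fintype.mem_piFinset, Finset.image_subset_iff,
      Finset.mem_univ, true_imp_iff]
    exact ⟨fun h j => ⟨h.2 j, h.1 j⟩, fun h => ⟨fun j => (h j).2, fun j => (h j).1⟩⟩
  rw [Finset.sum_congr rfl hWy, Finset.sum_const, nsmul_eq_mul] at hWs
  rw [Finset.sum_congr rfl hNy, Finset.sum_const, nsmul_eq_mul] at hNs
  have hS0 : (S.card : ℝ) ≠ 0 := by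
    rw [Nat.cast_ne_zero, Finset.card_ne_zero]
    exact ⟨x, (hmem x).2 hx⟩
  have hNx : N x = ((cycleInit idx m b).filter fun fT => univ.image x ⊆ fT.2).card := by
    simp only [hN, Finset.sum_boole]
  rw [← hNx]
  apply mul_left_cancel₀ hS0
  rw [hNs, ← hWs]
  ring

end Cycles

end Golf

namespace Golf

section Cut

variable {V ι : Type*} [Fintype V] [DecidableEq V] [Fintype ι]

/-- `idx` labels the vertices of the cycle `r` by the last marked vertex `x j` preceding them. -/
structure IsCut (r : Equiv.Perm V) (x : ι → V) (idx : V → ι) : Prop where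
  nonempty : Nonempty ι
  sameCycle : ∀ v w, r.SameCycle v w
  idx_mark : ∀ j, idx (x j) = j
  idx_next : ∀ v, r v ∉ univ.image x → idx (r v) = idx v

variable {r : Equiv.Perm V} {x : ι → V} {idx : V → ι}

/-- An induction principle along the blocks of a cycle cut at the vertices `x j`. -/
theorem cut_induction [Nonempty ι] (hr : ∀ v w, r.SameCycle v w) {P : V → Prop}
    (hx : ∀ j, P (x j)) (hnext : ∀ v, r v ∉ univ.image x → P v → P (r v)) (v : V) : P v := by
  obtain ⟨j⟩ := ‹Nonempty ι›
  obtain ⟨d, -, rfl⟩ := exists_pow_of_sameCycle (hr (x j) v)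
  induction d with
  | zero => exact hx j
  | succ d ih =>
    rw [pow_succ', Equiv.Perm.mul_apply]
    by_cases h : r ((r ^ d) (x j)) ∈ univ.image x
    · obtain ⟨i, -, hi⟩ := Finset.mem_image.1 h
      rw [← hi]
      exact hx i
    · exact hnext _ h ih

/-- The successor map in the union of cycles obtained by closing each block on itself. -/
def cutFun (r : Equiv.Perm V) (x : ι → V) (idx : V → ι) (v : V) : V :=
  if r v ∈ univ.image x then x (idx v) else r v

theorem cutFun_surjective (h : IsCut r x idx) : Function.Surjective (cutFun r x idx) := by
  intro w
  by_cases hw : w ∈ univ.image x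
  · obtain ⟨i, -, rfl⟩ := Finset.mem_image.1 hw
    obtain ⟨d0, hd0, hd0'⟩ := exists_pow_of_sameCycle (h.sameCycle (x i) (x i))
    obtain ⟨h1, h2, h3⟩ := hitTime_spec (s := r) (H := univ.image x) (v := x i)
      ⟨d0, hd0, by rw [hd0']; exact hw⟩
    obtain ⟨c, hc⟩ : ∃ c, hitTime r (univ.image x) (x i) = c + 1 := Nat.exists_eq_add_of_le' h1
    rw [hc] at h2 h3
    have key : ∀ d ≤ c, idx ((r ^ d) (x i)) = i := by
      intro d
      induction d with
      | zero => exact fun _ => h.idx_mark i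
      | succ d ih =>
        intro hd
        have := h3 (d + 1) (by omega) (by omega)
        rw [pow_succ', Equiv.Perm.mul_apply] at this ⊢
        rw [h.idx_next _ this, ih (by omega)]
    refine ⟨(r ^ c) (x i), ?_⟩
    rw [pow_succ', Equiv.Perm.mul_apply] at h2
    rw [cutFun, if_pos h2, key c le_rfl]
  · exact ⟨r⁻¹ w, by simp [cutFun, -Finset.mem_image, hw]⟩

/-- The permutation whose cycles are the blocks, each closed on itself. -/
noncomputable def cutPerm (h : IsCut r x idx) : Equiv.Perm V :=
  Equiv.ofBijective (cutFun r x idx) (Finite.surjective_iff_bijective.1 (cutFun_surjective h))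

theorem cutPerm_apply (h : IsCut r x idx) (v : V) :
    cutPerm h v = if r v ∈ univ.image x then x (idx v) else r v := rfl

theorem idx_eq_iff_sameCycle (h : IsCut r x idx) (v w : V) :
    idx v = idx w ↔ (cutPerm h).SameCycle v w := by
  have := h.nonempty
  have hbase : ∀ v, (cutPerm h).SameCycle (x (idx v)) v := by
    refine cut_induction h.sameCycle (x := x) (fun j => ?_) (fun v hv ih => ?_)
    · rw [h.idx_mark]
    · rw [h.idx_next v hv]
      have : r v = cutPerm h v := by rw [cutPerm_apply, if_neg hv]
      rw [this]
      exact Equiv.Perm.sameCycle_apply_right.2 ih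
  have hidx : ∀ v, idx (cutPerm h v) = idx v := by
    intro v
    rw [cutPerm_apply]
    split_ifs with hv
    · exact h.idx_mark _
    · exact h.idx_next v hv
  constructor
  · intro hvw
    exact (hbase v).symm.trans (hvw ▸ hbase w)
  · intro hvw
    obtain ⟨d, -, rfl⟩ := exists_pow_of_sameCycle hvw
    induction d with
    | zero => rfl
    | succ d ih =>
      rw [pow_succ', Equiv.Perm.mul_apply, hidx]
      exact ih ⟨d, by rw [zpow_natCast]⟩

theorem cutPerm_pow (h : IsCut r x idx) (v : V) (d : ℕ)
    (hd : ∀ e, 1 ≤ e → e ≤ d → (r ^ e) v ∉ univ.image x) : (cutPerm h ^ d) v = (r ^ d) v := by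
  induction d with
  | zero => rfl
  | succ d ih =>
    have h1 := hd (d + 1) (by omega) le_rfl
    rw [pow_succ', Equiv.Perm.mul_apply] at h1
    rw [pow_succ', pow_succ', Equiv.Perm.mul_apply, Equiv.Perm.mul_apply,
      ih fun e he he' => hd e he (by omega), cutPerm_apply, if_neg h1]

theorem cutPerm_inv_pow (h : IsCut r x idx) (v : V) (d : ℕ)
    (hd : ∀ e < d, (r⁻¹ ^ e) v ∉ univ.image x) : ((cutPerm h)⁻¹ ^ d) v = (r⁻¹ ^ d) v := by
  induction d with
  | zero => rfl
  | succ d ih =>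
    have h1 := hd d (by omega)
    rw [pow_succ', pow_succ', Equiv.Perm.mul_apply, Equiv.Perm.mul_apply,
      ih fun e he => hd e (by omega), Equiv.Perm.inv_eq_iff_eq, cutPerm_apply]
    rw [← Equiv.Perm.mul_apply, mul_inv_cancel, Equiv.Perm.one_apply, if_neg h1]

section Coupling

variable (h : IsCut r x idx) {H : Finset V} {v : V} (hH : univ.image x ⊆ H)

include hH

theorem exists_hit (h : IsCut r x idx) (v : V) : ∃ d, 1 ≤ d ∧ (r ^ d) v ∈ H := by
  obtain ⟨j⟩ := h.nonempty
  obtain ⟨d, hd, hd'⟩ := exists_pow_of_sameCycle (h.sameCycle v (x j))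
  exact ⟨d, hd, hd' ▸ hH (by simp)⟩

theorem exists_hit_inv (h : IsCut r x idx) (v : V) : ∃ d, 1 ≤ d ∧ (r⁻¹ ^ d) v ∈ H := by
  obtain ⟨j⟩ := h.nonempty
  obtain ⟨d, hd, hd'⟩ := exists_pow_of_sameCycle
    (Equiv.Perm.sameCycle_inv.2 (h.sameCycle v (x j)))
  exact ⟨d, hd, hd' ▸ hH (by simp)⟩

theorem cutPerm_hit (v : V) : hitTime (cutPerm h) H v = hitTime r H v ∧
    ((cutPerm h ^ hitTime r H v) v = (r ^ hitTime r H v) v ∨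
      ((cutPerm h ^ hitTime r H v) v ∈ univ.image x ∧ (r ^ hitTime r H v) v ∈ univ.image x)) := by
  obtain ⟨h1, h2, h3⟩ := hitTime_spec (exists_hit hH h v)
  have hlt : ∀ d, d < hitTime r H v → (cutPerm h ^ d) v = (r ^ d) v := fun d hd =>
    cutPerm_pow h v d fun e he he' hm => h3 e he (by omega) (hH hm)
  have hc : (cutPerm h ^ hitTime r H v) v = (r ^ hitTime r H v) v ∨
      ((cutPerm h ^ hitTime r H v) v ∈ univ.image x ∧
        (r ^ hitTime r H v) v ∈ univ.image x) := by
    obtain ⟨c, hc⟩ : ∃ c, hitTime r H v = c + 1 := Nat.exists_eq_add_of_le' h1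
    have := hlt c (by omega)
    rw [hc, pow_succ', pow_succ', Equiv.Perm.mul_apply, Equiv.Perm.mul_apply, this, cutPerm_apply]
    split_ifs with hm
    · exact Or.inr ⟨by simp, hm⟩
    · exact Or.inl rfl
  refine ⟨hitTime_eq h1 ?_ fun d hd hd' => ?_, hc⟩
  · rcases hc with hc | hc
    · rwa [hc]
    · exact hH hc.1
  · rw [hlt d hd']
    exact h3 d hd hd'

theorem cutPerm_hit_inv (hv : v ∉ H) : hitTime (cutPerm h)⁻¹ H v = hitTime r⁻¹ H v ∧
    ((cutPerm h)⁻¹ ^ hitTime r⁻¹ H v) v = (r⁻¹ ^ hitTime r⁻¹ H v) v := by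
  obtain ⟨h1, h2, h3⟩ := hitTime_spec (exists_hit_inv hH h v)
  have hle : ∀ d, d ≤ hitTime r⁻¹ H v → ((cutPerm h)⁻¹ ^ d) v = (r⁻¹ ^ d) v := by
    refine fun d hd => cutPerm_inv_pow h v d fun e he hm => ?_
    rcases Nat.eq_zero_or_pos e with rfl | he0
    · exact hv (hH (by simpa using hm))
    · exact h3 e he0 (by omega) (hH hm)
  refine ⟨hitTime_eq h1 (by rwa [hle _ le_rfl]) fun d hd hd' => ?_, hle _ le_rfl⟩
  rw [hle d hd'.le]
  exact h3 d hd hd'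

theorem permProb_cutPerm (p : ℝ) (hv : v ∉ H) :
    permProb p r H v = permProb p (cutPerm h) H v := by
  rw [permProb, permProb, (cutPerm_hit h hH v).1, (cutPerm_hit_inv h hH hv).1]

theorem permStep_cutPerm (hv : v ∉ H) (c : Bool) :
    permStep r H v c = permStep (cutPerm h) H v c ∨
      (¬ univ.image x ⊆ permStep r H v c ∧ ¬ univ.image x ⊆ permStep (cutPerm h) H v c) := by
  cases c with
  | true =>
    simp only [permStep, if_true]
    rw [(cutPerm_hit h hH v).1]
    rcases (cutPerm_hit h hH v).2 with he | ⟨h1, h2⟩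
    · left
      rw [he]
    · right
      exact ⟨fun hs => Finset.notMem_erase _ _ (hs h2), fun hs => Finset.notMem_erase _ _ (hs h1)⟩
  | false =>
    left
    simp only [permStep, Bool.false_eq_true, if_false]
    rw [(cutPerm_hit_inv h hH hv).1, (cutPerm_hit_inv h hH hv).2]

end Coupling

theorem cycleInit_nonempty [DecidableEq ι] (hx : ∀ j, idx (x j) = j) {m : ℕ} {b : ι → ℕ} (hb : ∑ j, b j = m)
    (hcard : ∀ j, 2 * b j + 1 ≤ (univ.filter fun v => idx v = j).card) :
    ((cycleInit idx m b).filter fun fT => univ.image x ⊆ fT.2).Nonempty := by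
  have h1 : ∀ j, ∃ A D : Finset V, Disjoint A D ∧ A.card = b j ∧ D.card = b j + 1 ∧ x j ∈ D ∧
      ∀ v ∈ A ∪ D, idx v = j := by
    intro j
    have hxj : x j ∈ univ.filter fun v => idx v = j := by simp [hx]
    obtain ⟨D, hxD, hDs, hD⟩ := Finset.exists_subsuperset_card_eq
      (Finset.singleton_subset_iff.2 hxj) (n := b j + 1) (by simp) (by have := hcard j; omega)
    obtain ⟨A, hAs, hA⟩ := Finset.exists_subset_card_eq
      (s := (univ.filter fun v => idx v = j) \ D) (n := b j)
      (by rw [Finset.card_sdiff_of_subset hDs]; have := hcard j; omega)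
    refine ⟨A, D, ?_, hA, hD, hxD (by simp), ?_⟩
    · exact Finset.disjoint_of_subset_left hAs Finset.sdiff_disjoint
    · intro v hv
      rcases Finset.mem_union.1 hv with hv | hv
      · have := Finset.mem_sdiff.1 (hAs hv)
        simpa using this.1
      · simpa using hDs hv
  choose A D hAD hA hD hxD hidx using h1
  have hAf : ∀ j, ((univ.biUnion A).filter fun v => idx v = j) = A j := by
    intro j
    ext v
    simp only [Finset.mem_filter, Finset.mem_biUnion, Finset.mem_univ, true_and]
    constructor
    · rintro ⟨⟨i, hi⟩, rfl⟩
      rwa [hidx i v (Finset.mem_union_left _ hi)]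
    · exact fun hv => ⟨⟨j, hv⟩, hidx j v (Finset.mem_union_left _ hv)⟩
  have hDf : ∀ j, ((univ.biUnion D).filter fun v => idx v = j) = D j := by
    intro j
    ext v
    simp only [Finset.mem_filter, Finset.mem_biUnion, Finset.mem_univ, true_and]
    constructor
    · rintro ⟨⟨i, hi⟩, rfl⟩
      rwa [hidx i v (Finset.mem_union_right _ hi)]
    · exact fun hv => ⟨⟨j, hv⟩, hidx j v (Finset.mem_union_right _ hv)⟩
  have hcA : (univ.biUnion A).card = m := by
    rw [Finset.card_eq_sum_card_fiberwise (f := idx) (t := univ) (by simp)]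
    simp [hAf, hA, hb]
  let e := (Finset.equivFinOfCardEq hcA).symm
  let f : Fin m ↪ V := e.toEmbedding.trans (Function.Embedding.subtype _)
  have hf : univ.map f = univ.biUnion A := by
    rw [← Finset.map_map, Finset.map_univ_equiv]
    exact Finset.attach_map_val
  refine ⟨(f, univ.biUnion D), ?_⟩
  simp only [cycleInit, Finset.mem_filter, Finset.mem_univ, true_and]
  refine ⟨⟨fun i hi => ?_, fun j => ?_, fun j => by rw [hDf, hD]⟩, ?_⟩
  · have hA' : f i ∈ univ.biUnion A := hf ▸ Finset.mem_map_of_mem f (Finset.mem_univ i)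
    have h1 : f i ∈ A (idx (f i)) := by rw [← hAf]; simpa using hA'
    have h2 : f i ∈ D (idx (f i)) := by rw [← hDf]; simpa using hi
    exact Finset.disjoint_left.1 (hAD _) h1 h2
  · rw [← hA j, ← hAf j, ← hf, Finset.filter_map, Finset.card_map]
    rfl
  · intro v hv
    obtain ⟨j, -, rfl⟩ := Finset.mem_image.1 hv
    exact Finset.mem_biUnion.2 ⟨j, Finset.mem_univ j, hxD j⟩

end Cut

end Golf

namespace Golf

theorem sum_choices {n : ℕ} (p : ℝ) (φ : Finset (Fin n) → ℝ) (m : ℕ) (l : List (Fin n))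
    (hl : l.length = m) (H : Finset (Fin n)) :
    ∑ cs : Fin m → Bool, golfWeight p l (List.ofFn cs) H * φ (golfRun l (List.ofFn cs) H) =
      runExp (rightProb p) golfStep φ l H := by
  induction m generalizing l H with
  | zero =>
    obtain rfl := List.length_eq_zero_iff.1 hl
    simp [golfWeight, golfRun, runExp]
  | succ m ih =>
    obtain ⟨v, vs, rfl⟩ := List.exists_cons_of_length_eq_add_one hl
    have hvs : vs.length = m := by simpa using hl
    rw [← (Fin.consEquiv fun _ : Fin (m + 1) => Bool).sum_comp, Fintype.sum_prod_type]
    simp [Fin.consEquiv, List.ofFn_succ, golfWeight, golfRun, runExp, mul_assoc,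
      ← Finset.mul_sum, ih vs hvs]

section Shift

variable {n : ℕ}

theorem shiftR_shiftR (v : Fin n) (a c : ℕ) : shiftR (shiftR v a) c = shiftR v (a + c) := by
  simp [shiftR, add_assoc]

theorem shiftR_of_dvd (v : Fin n) {d : ℕ} (h : n ∣ d) : shiftR v d = v := by
  obtain ⟨k, rfl⟩ := h
  ext
  simp [shiftR, Nat.mod_eq_of_lt v.isLt]

theorem dvd_add_sub_mod (hn : 0 < n) (d : ℕ) : n ∣ d + (n - d % n) := by
  refine ⟨d / n + 1, ?_⟩
  have h1 := Nat.div_add_mod d n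
  have h2 := Nat.mod_lt d hn
  rw [mul_add, mul_one]
  omega

theorem shiftR_shiftL (v : Fin n) (d : ℕ) : shiftR (shiftL v d) d = v := by
  rw [shiftL, shiftR_shiftR, add_comm]
  exact shiftR_of_dvd v (dvd_add_sub_mod v.pos d)

theorem shiftL_shiftR (v : Fin n) (d : ℕ) : shiftL (shiftR v d) d = v := by
  rw [shiftL, shiftR_shiftR]
  exact shiftR_of_dvd v (dvd_add_sub_mod v.pos d)

/-- The rotation `v ↦ v + 1` of the cycle. -/
def rot (n : ℕ) : Equiv.Perm (Fin n) where
  toFun v := shiftR v 1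
  invFun v := shiftL v 1
  left_inv v := shiftL_shiftR v 1
  right_inv v := shiftR_shiftL v 1

theorem rot_pow (v : Fin n) (d : ℕ) : (rot n ^ d) v = shiftR v d := by
  induction d with
  | zero => exact (shiftR_of_dvd v (dvd_zero n)).symm
  | succ d ih =>
    rw [pow_succ', Equiv.Perm.mul_apply, ih, ← shiftR_shiftR]
    rfl

theorem rot_inv_pow (v : Fin n) (d : ℕ) : ((rot n)⁻¹ ^ d) v = shiftL v d := by
  rw [inv_pow, Equiv.Perm.inv_eq_iff_eq, rot_pow, shiftR_shiftL]

theorem exists_shiftR_eq (v w : Fin n) : ∃ d ∈ Finset.Icc 1 n, shiftR v d = w := by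
  have hv := v.isLt
  have hw := w.isLt
  by_cases h : v.val < w.val
  · refine ⟨w - v, Finset.mem_Icc.2 ⟨by omega, by omega⟩, Fin.ext ?_⟩
    simp only [shiftR]
    rw [Nat.add_sub_of_le h.le, Nat.mod_eq_of_lt hw]
  · refine ⟨w + n - v, Finset.mem_Icc.2 ⟨by omega, by omega⟩, Fin.ext ?_⟩
    simp only [shiftR]
    rw [show v.val + (w.val + n - v.val) = w.val + n by omega, Nat.add_mod_right,
      Nat.mod_eq_of_lt hw]

theorem exists_shiftL_eq (v w : Fin n) : ∃ d ∈ Finset.Icc 1 n, shiftL v d = w := by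
  obtain ⟨d, hd, rfl⟩ := exists_shiftR_eq w v
  exact ⟨d, hd, shiftL_shiftR w d⟩

theorem rot_sameCycle (v w : Fin n) : (rot n).SameCycle v w := by
  obtain ⟨d, -, hd⟩ := exists_shiftR_eq v w
  exact ⟨d, by rw [zpow_natCast, rot_pow, hd]⟩

theorem distR_eq {H : Finset (Fin n)} (hH : H.Nonempty) (v : Fin n) :
    distR H v = hitTime (rot n) H v := by
  obtain ⟨w, hw⟩ := hH
  obtain ⟨d, hd, rfl⟩ := exists_shiftR_eq v w
  have hne : ((Finset.Icc 1 n).filter fun d => shiftR v d ∈ H).Nonempty :=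
    ⟨d, Finset.mem_filter.2 ⟨hd, hw⟩⟩
  have hmin := Finset.min'_mem _ hne
  rw [distR, dif_pos hne]
  simp only [Finset.mem_filter, Finset.mem_Icc] at hmin
  refine (hitTime_eq hmin.1.1 (by rw [rot_pow]; exact hmin.2) fun e he he' hm => ?_).symm
  rw [rot_pow] at hm
  exact absurd he' (not_lt.2 (Finset.min'_le _ _
    (Finset.mem_filter.2 ⟨Finset.mem_Icc.2 ⟨he, by omega⟩, hm⟩)))

theorem distL_eq {H : Finset (Fin n)} (hH : H.Nonempty) (v : Fin n) :
    distL H v = hitTime (rot n)⁻¹ H v := by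
  obtain ⟨w, hw⟩ := hH
  obtain ⟨d, hd, rfl⟩ := exists_shiftL_eq v w
  have hne : ((Finset.Icc 1 n).filter fun d => shiftL v d ∈ H).Nonempty :=
    ⟨d, Finset.mem_filter.2 ⟨hd, hw⟩⟩
  have hmin := Finset.min'_mem _ hne
  rw [distL, dif_pos hne]
  simp only [Finset.mem_filter, Finset.mem_Icc] at hmin
  refine (hitTime_eq hmin.1.1 (by rw [rot_inv_pow]; exact hmin.2) fun e he he' hm => ?_).symm
  rw [rot_inv_pow] at hm
  exact absurd he' (not_lt.2 (Finset.min'_le _ _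
    (Finset.mem_filter.2 ⟨Finset.mem_Icc.2 ⟨he, by omega⟩, hm⟩)))

theorem rightProb_eq {H : Finset (Fin n)} (hH : H.Nonempty) (p : ℝ) (v : Fin n) :
    rightProb p H v = permProb p (rot n) H v := by
  rw [permProb, ← distR_eq hH, ← distL_eq hH]
  rfl

theorem golfStep_eq {H : Finset (Fin n)} (hH : H.Nonempty) (v : Fin n) (c : Bool) :
    golfStep H v c = permStep (rot n) H v c := by
  rw [permStep, golfStep, ← distR_eq hH, ← distL_eq hH, rot_pow, rot_inv_pow]

theorem golfStep_subset (H : Finset (Fin n)) (v : Fin n) (c : Bool) : golfStep H v c ⊆ H := by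
  unfold golfStep
  split_ifs <;> exact Finset.erase_subset _ _

theorem runExp_golf_eq_cutPerm {ι : Type*} [Fintype ι] {x : ι → Fin n}
    {idx : Fin n → ι} (h : IsCut (rot n) x idx) (p : ℝ) (l : List (Fin n)) (H : Finset (Fin n))
    (hl : ∀ v ∈ l, v ∉ H) :
    runExp (rightProb p) golfStep (fun T => if T = univ.image x then 1 else 0) l H =
      runExp (permProb p (cutPerm h)) (permStep (cutPerm h))
        (fun T => if T = univ.image x then 1 else 0) l H := by
  have hne : ∀ H : Finset (Fin n), univ.image x ⊆ H → H.Nonempty := fun H hH => by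
    obtain ⟨j⟩ := h.nonempty
    exact ⟨x j, hH (by simp)⟩
  refine runExp_coupling _ _ _ _ golfStep_subset (permStep_subset _) _ ?_ ?_ l H hl
  · intro H v hH hv
    rw [rightProb_eq (hne H hH), permProb_cutPerm h hH p hv]
  · intro H v c hH hv
    rw [golfStep_eq (hne H hH)]
    exact permStep_cutPerm h hH hv c

end Shift

section Blocks

variable {n : ℕ}

theorem cpos_mem (v : Fin n) : 1 ≤ cpos v ∧ cpos v ≤ n := by
  have := v.isLt
  unfold cpos
  split_ifs <;> omega

theorem cpos_injective : Function.Injective (cpos (n := n)) := by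
  intro v w h
  have hv := v.isLt
  have hw := w.isLt
  unfold cpos at h
  ext
  split_ifs at h <;> omega

theorem cpos_rot (v : Fin n) : cpos (rot n v) = if cpos v = n then 1 else cpos v + 1 := by
  have hv := v.isLt
  have hval : (rot n v).val = if v.val + 1 = n then 0 else v.val + 1 := by
    change (v.val + 1) % n = _
    split_ifs with h1
    · rw [h1, Nat.mod_self]
    · exact Nat.mod_eq_of_lt (by omega)
  have hc : ∀ w : Fin n, w.val = 0 ∧ cpos w = n ∨ w.val ≠ 0 ∧ cpos w = w.val := by
    intro w
    by_cases h : w.val = 0 <;> simp [cpos, h]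
  have h1 := hc v
  have h2 := hc (rot n v)
  split_ifs at hval ⊢ <;> omega

theorem exists_cpos_eq {c : ℕ} (h1 : 1 ≤ c) (h2 : c ≤ n) : ∃ v : Fin n, cpos v = c := by
  rcases h2.lt_or_eq with h | rfl
  · exact ⟨⟨c, h⟩, by rw [cpos, if_neg (by simp; omega)]⟩
  · exact ⟨⟨0, h1⟩, by simp [cpos]⟩

variable (X : Finset (Fin n))

theorem length_sortedPos : (sortedPos X).length = X.card := by
  rw [sortedPos, Finset.length_sort, Finset.card_image_of_injective _ cpos_injective]

theorem exists_cpos_eq_getD {j : ℕ} (hj : j < X.card) :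
    ∃ v ∈ X, cpos v = (sortedPos X).getD j 0 := by
  have hj' : j < (sortedPos X).length := by rwa [length_sortedPos]
  have hm : (sortedPos X)[j] ∈ X.image cpos := by
    rw [← Finset.mem_sort (· ≤ ·)]
    exact List.getElem_mem hj'
  rw [List.getD_eq_getElem _ _ hj']
  exact Finset.mem_image.1 hm

variable {X}

theorem exists_getD_eq_cpos {v : Fin n} (hv : v ∈ X) :
    ∃ j < X.card, (sortedPos X).getD j 0 = cpos v := by
  have hm : cpos v ∈ sortedPos X := by
    rw [sortedPos, Finset.mem_sort]
    exact Finset.mem_image_of_mem _ hv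
  obtain ⟨j, hj, hj'⟩ := List.getElem_of_mem hm
  exact ⟨j, by rwa [length_sortedPos] at hj, by rw [List.getD_eq_getElem _ _ hj, hj']⟩

theorem getD_sortedPos_lt {i j : ℕ} (hij : i < j) (hj : j < X.card) :
    (sortedPos X).getD i 0 < (sortedPos X).getD j 0 := by
  have hj' : j < (sortedPos X).length := by rwa [length_sortedPos]
  rw [List.getD_eq_getElem _ _ hj', List.getD_eq_getElem _ _ (hij.trans hj')]
  exact (Finset.sortedLT_sort (X.image cpos)).getElem_lt_getElem_of_lt hij

/-- Index of the marked vertex preceding the `i`-th block. -/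
def prevIdx (k i : ℕ) : ℕ := if i = 0 then k - 1 else i - 1

theorem mod_eq_prevIdx {k i : ℕ} (hi : i < k) : (i + k - 1) % k = prevIdx k i := by
  unfold prevIdx
  split_ifs with h
  · rw [h, zero_add, Nat.mod_eq_of_lt (by omega)]
  · rw [show i + k - 1 = i - 1 + k by omega, Nat.add_mod_right, Nat.mod_eq_of_lt (by omega)]

theorem mem_blockSet {i : ℕ} (hi : i < X.card) (v : Fin n) :
    v ∈ blockSet X i ↔
      if (sortedPos X).getD (prevIdx X.card i) 0 < (sortedPos X).getD i 0 then
        (sortedPos X).getD (prevIdx X.card i) 0 < cpos v ∧ cpos v < (sortedPos X).getD i 0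
      else cpos v < (sortedPos X).getD i 0 ∨ (sortedPos X).getD (prevIdx X.card i) 0 < cpos v := by
  simp only [blockSet, Finset.mem_filter, Finset.mem_univ, true_and, length_sortedPos,
    mod_eq_prevIdx hi, Nat.mod_eq_of_lt hi]

theorem notMem_of_mem_blockSet {i : ℕ} (hi : i < X.card) {v : Fin n} (hv : v ∈ blockSet X i) :
    v ∉ X := by
  intro hvX
  obtain ⟨j, hj, hj'⟩ := exists_getD_eq_cpos hvX
  rw [mem_blockSet hi, ← hj'] at hv
  have hmono : ∀ a c, c < X.card → (sortedPos X).getD a 0 < (sortedPos X).getD c 0 →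
      a < X.card → a < c := by
    intro a c hc hlt ha
    by_contra hcon
    rcases (not_lt.1 hcon).lt_or_eq with h | h
    · exact absurd (getD_sortedPos_lt h ha) hlt.not_gt
    · exact absurd (h ▸ hlt) (lt_irrefl _)
  have hp : prevIdx X.card i < X.card := by unfold prevIdx; split_ifs <;> omega
  by_cases h0 : i = 0
  · have hlt : ¬ (sortedPos X).getD (prevIdx X.card i) 0 < (sortedPos X).getD i 0 := by
      intro hlt
      have := hmono _ _ hi hlt hp
      omega
    rw [if_neg hlt] at hv
    rcases hv with hv | hv
    · have := hmono _ _ hi hv hj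
      omega
    · have := hmono _ _ hj hv hp
      simp only [prevIdx, h0, if_true] at this
      omega
  · have hpi : prevIdx X.card i = i - 1 := if_neg h0
    rw [if_pos (hpi ▸ getD_sortedPos_lt (by omega) hi), hpi] at hv
    have h1 := hmono _ _ hj hv.1 (by omega)
    have h2 := hmono _ _ hi hv.2 hj
    omega

theorem card_blockSet {i : ℕ} (hi : i < X.card) : (blockSet X i).card = blockSize X i := by
  have hp : prevIdx X.card i < X.card := by unfold prevIdx; split_ifs <;> omega
  obtain ⟨a, -, ha⟩ := exists_cpos_eq_getD X hp
  obtain ⟨c, -, hc⟩ := exists_cpos_eq_getD X hi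
  have ha' := cpos_mem a
  have hc' := cpos_mem c
  have hsize : blockSize X i = (cpos c + n - cpos a - 1) % n := by
    simp only [blockSize, length_sortedPos, mod_eq_prevIdx hi, Nat.mod_eq_of_lt hi, ha, hc]
  have hmem : ∀ v, v ∈ blockSet X i ↔ if cpos a < cpos c then cpos a < cpos v ∧ cpos v < cpos c
      else cpos v < cpos c ∨ cpos a < cpos v := fun v => by rw [mem_blockSet hi, ha, hc]
  rw [← Finset.card_image_of_injective _ cpos_injective, hsize]
  by_cases hlt : cpos a < cpos c
  · have : (blockSet X i).image cpos = Finset.Ioo (cpos a) (cpos c) := by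
      ext d
      simp only [Finset.mem_image, hmem, if_pos hlt, Finset.mem_Ioo]
      constructor
      · rintro ⟨v, hv, rfl⟩
        exact hv
      · intro hd
        obtain ⟨v, rfl⟩ := exists_cpos_eq (n := n) (c := d) (by omega) (by omega)
        exact ⟨v, hd, rfl⟩
    rw [this, Nat.card_Ioo, show cpos c + n - cpos a - 1 = cpos c - cpos a - 1 + n by omega,
      Nat.add_mod_right, Nat.mod_eq_of_lt (by omega)]
  · have : (blockSet X i).image cpos = Finset.Ico 1 (cpos c) ∪ Finset.Ioc (cpos a) n := by
      ext d
      simp only [Finset.mem_image, hmem, if_neg hlt, Finset.mem_union, Finset.mem_Ico,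
        Finset.mem_Ioc]
      constructor
      · rintro ⟨v, hv, rfl⟩
        have := cpos_mem v
        omega
      · intro hd
        obtain ⟨v, rfl⟩ := exists_cpos_eq (n := n) (c := d) (by omega) (by omega)
        exact ⟨v, by omega, rfl⟩
    rw [this, Finset.card_union_of_disjoint, Nat.card_Ico, Nat.card_Ioc,
      Nat.mod_eq_of_lt (by omega)]
    · omega
    · rw [Finset.disjoint_left]
      intro d hd hd'
      rw [Finset.mem_Ico] at hd
      rw [Finset.mem_Ioc] at hd'
      omega

/-- The blocks of `X`, together with their left endpoints, are the classes of a cut of the cycle. -/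
theorem exists_isCut {k : ℕ} (hk : 0 < k) (hX : X.card = k) :
    ∃ (x : Fin k → Fin n) (idx : Fin n → Fin k), IsCut (rot n) x idx ∧ univ.image x = X ∧
      ∀ v i, idx v = i ↔ v = x i ∨ v ∈ blockSet X i.val := by
  have hi : ∀ i : Fin k, i.val < X.card := fun i => hX ▸ i.isLt
  have hp : ∀ i : Fin k, prevIdx X.card i < X.card := by
    intro i
    have := hi i
    unfold prevIdx
    split_ifs <;> omega
  choose x hxX hx using fun i : Fin k => exists_cpos_eq_getD X (hp i)
  have hinj : Function.Injective x := by
    intro i j hij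
    have h1 : (sortedPos X).getD (prevIdx X.card i) 0 = (sortedPos X).getD (prevIdx X.card j) 0 :=
      by rw [← hx, ← hx, hij]
    have h2 : prevIdx X.card i = prevIdx X.card j := by
      rcases lt_trichotomy (prevIdx X.card i) (prevIdx X.card j) with h | h | h
      · exact absurd h1 (getD_sortedPos_lt h (hp j)).ne
      · exact h
      · exact absurd h1 (getD_sortedPos_lt h (hp i)).ne'
    have := hi i
    have := hi j
    unfold prevIdx at h2
    ext
    split_ifs at h2 <;> omega
  have himg : univ.image x = X := by
    apply Finset.eq_of_subset_of_card_le
    · intro v hv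
      obtain ⟨i, -, rfl⟩ := Finset.mem_image.1 hv
      exact hxX i
    · rw [Finset.card_image_of_injective _ hinj, hX, Finset.card_univ, Fintype.card_fin]
  have hC : ∀ v i, rot n v ∉ X → ((rot n v = x i ∨ rot n v ∈ blockSet X i.val) ↔
      (v = x i ∨ v ∈ blockSet X i.val)) := by
    intro v i hv
    obtain ⟨c, hcX, hc⟩ := exists_cpos_eq_getD X (hi i)
    have h1 : cpos (rot n v) ≠ cpos c := fun h => hv (cpos_injective h ▸ hcX)
    have h2 : rot n v ≠ x i := fun h => hv (h ▸ hxX i)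
    have h3 := cpos_rot v
    have h4 := cpos_mem v
    have h5 := cpos_mem c
    have h6 := cpos_mem (x i)
    rw [mem_blockSet (hi i), mem_blockSet (hi i), ← hx, ← hc, ← cpos_injective.eq_iff,
      ← cpos_injective.eq_iff (a := v)]
    have h7 : cpos (rot n v) ≠ cpos (x i) := cpos_injective.ne h2
    split_ifs at h3 ⊢ <;> omega
  have : Nonempty (Fin k) := ⟨⟨0, hk⟩⟩
  have hex : ∀ v, ∃! i : Fin k, v = x i ∨ v ∈ blockSet X i.val := by
    refine cut_induction rot_sameCycle (x := x) (fun j => ?_) (fun v hv ih => ?_)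
    · refine ⟨j, Or.inl rfl, fun i h => ?_⟩
      rcases h with h | h
      · exact (hinj h).symm
      · exact absurd (hxX j) (notMem_of_mem_blockSet (hi i) h)
    · rw [himg] at hv
      simpa only [hC v _ hv] using ih
  choose idx hidx huniq using hex
  have hiff : ∀ v i, idx v = i ↔ v = x i ∨ v ∈ blockSet X i.val := fun v i =>
    ⟨fun h => h ▸ hidx v, fun h => (huniq v i h).symm⟩
  refine ⟨x, idx, ⟨this, rot_sameCycle, fun j => (hiff _ _).2 (Or.inl rfl), fun v hv => ?_⟩, himg,
    hiff⟩
  rw [himg] at hv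
  rw [hiff, hC v _ hv]
  exact hidx v

end Blocks

end Golf

/-- **Block decomposition of the golf model on `Z/nZ`** (Lemma 2.2 of the paper).
With `K = nt - nb > 0`, `X` of cardinality `K` and `(b_i)` nonnegative integers with
`Σ b_i = nb` and `2 b_i ≤ Δ_i X`, conditionally on `X ⊆ T⁰` and on the event that for each `i`
the block `B_i` of `X` contains exactly `b_i` balls and `b_i` holes of the initial
configuration, one has `P(TL = X | ·) = Π_i 1/(b_i + 1)`. -/
theorem golf_block_decomposition (n nb nt : ℕ) (hn : 1 ≤ n) (hnbt : nb + nt ≤ n)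
    (hK : nb < nt) (p : ℝ) (hp0 : 0 < p) (hp1 : p < 1)
    (X : Finset (Fin n)) (hX : X.card = nt - nb)
    (b : Fin (nt - nb) → ℕ) (hb : ∑ i, b i = nb)
    (hbl : ∀ i, 2 * b i ≤ blockSize X i.val) :
    (golfExp n nb nt p fun B T TL =>
        if TL = X ∧ X ⊆ T ∧ ∀ i : Fin (nt - nb),
            (blockSet X i.val ∩ B).card = b i ∧ (blockSet X i.val ∩ T).card = b i
        then 1 else 0) /
      (golfExp n nb nt p fun B T _ =>
        if X ⊆ T ∧ ∀ i : Fin (nt - nb),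
            (blockSet X i.val ∩ B).card = b i ∧ (blockSet X i.val ∩ T).card = b i
        then 1 else 0) =
    ∏ i : Fin (nt - nb), 1 / ((b i : ℝ) + 1) := by
  obtain ⟨x, idx, hcut, himg, hidx⟩ := exists_isCut (Nat.sub_pos_of_lt hK) hX
  have hi : ∀ i : Fin (nt - nb), i.val < X.card := fun i => hX.symm ▸ i.isLt
  have hxB : ∀ i, x i ∉ blockSet X i.val := fun i h =>
    notMem_of_mem_blockSet (hi i) h (himg ▸ Finset.mem_image_of_mem x (Finset.mem_univ i))
  have hxX : ∀ i, x i ∈ X := fun i => himg ▸ Finset.mem_image_of_mem x (Finset.mem_univ i)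
  have hevent : (golfInit n nb nt).filter (fun fT => X ⊆ fT.2 ∧ ∀ i : Fin (nt - nb),
      (blockSet X i.val ∩ Finset.univ.map fT.1).card = b i ∧
        (blockSet X i.val ∩ fT.2).card = b i) =
      (cycleInit idx nb b).filter fun fT => univ.image x ⊆ fT.2 := by
    ext ⟨f, T⟩
    have hballs : X ⊆ T → (∀ i, f i ∉ T) → ∀ j, (blockSet X j.val ∩ Finset.univ.map f).card =
        (univ.filter fun i => idx (f i) = j).card := by
      intro hXT hfT j
      rw [← Finset.card_map f]
      congr 1
      ext v
      simp only [Finset.mem_inter, Finset.mem_map, Finset.mem_univ, true_and, Finset.mem_filter]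
      constructor
      · rintro ⟨hv, i, rfl⟩
        exact ⟨i, (hidx _ _).2 (Or.inr hv), rfl⟩
      · rintro ⟨i, hij, rfl⟩
        exact ⟨((hidx _ _).1 hij).resolve_left fun h => hfT i (hXT (by rw [h]; exact hxX j)), i, rfl⟩
    have hholes : X ⊆ T → ∀ j, (T.filter fun v => idx v = j).card =
        (blockSet X j.val ∩ T).card + 1 := by
      intro hXT j
      rw [← Finset.card_insert_of_notMem (a := x j) fun h => hxB j (Finset.mem_inter.1 h).1]
      congr 1
      ext v
      simp only [Finset.mem_insert, Finset.mem_inter, Finset.mem_filter, hidx]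
      constructor
      · rintro ⟨hv, h | h⟩
        · exact Or.inl h
        · exact Or.inr ⟨h, hv⟩
      · rintro (rfl | ⟨h, hv⟩)
        · exact ⟨hXT (hxX j), Or.inl rfl⟩
        · exact ⟨hv, Or.inr h⟩
    simp only [golfInit, cycleInit, Finset.mem_filter, Finset.mem_univ, true_and, himg]
    constructor
    · rintro ⟨⟨-, hfT⟩, hXT, hB⟩
      refine ⟨⟨hfT, fun j => ?_, fun j => ?_⟩, hXT⟩
      · rw [← hballs hXT hfT, (hB j).1]
      · rw [hholes hXT, (hB j).2]
    · rintro ⟨⟨hfT, hB, hT⟩, hXT⟩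
      refine ⟨⟨?_, hfT⟩, hXT, fun j => ⟨?_, ?_⟩⟩
      · rw [Finset.card_eq_sum_card_fiberwise (f := idx) (t := univ) (by simp)]
        simp only [hT, Finset.sum_add_distrib, hb]
        simp
        omega
      · rw [hballs hXT hfT, hB]
      · have := hholes hXT j
        rw [hT] at this
        omega
  have hne : ((cycleInit idx nb b).filter fun fT => univ.image x ⊆ fT.2).Nonempty := by
    refine cycleInit_nonempty hcut.idx_mark hb fun j => ?_
    have : (univ.filter fun v => idx v = j) = insert (x j) (blockSet X j.val) := by
      ext v
      simp [hidx]
    rw [this, Finset.card_insert_of_notMem (hxB j), card_blockSet (hi j)]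
    exact Nat.succ_le_succ (hbl j)
  have hden : (∑ fT ∈ golfInit n nb nt, ∑ cs : Fin nb → Bool,
      golfWeight p (List.ofFn ⇑fT.1) (List.ofFn cs) fT.2 *
        if X ⊆ fT.2 ∧ ∀ i : Fin (nt - nb),
            (blockSet X i.val ∩ Finset.univ.map fT.1).card = b i ∧
              (blockSet X i.val ∩ fT.2).card = b i
        then (1 : ℝ) else 0) =
      ((cycleInit idx nb b).filter fun fT => univ.image x ⊆ fT.2).card := by
    rw [← hevent, ← Finset.sum_boole]
    refine Finset.sum_congr rfl fun fT _ => ?_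
    have hmass : ∀ a : ℝ, ∑ cs : Fin nb → Bool,
        golfWeight p (List.ofFn ⇑fT.1) (List.ofFn cs) fT.2 * a = a := fun a =>
      (sum_choices p (fun _ => a) nb _ List.length_ofFn fT.2).trans (runExp_const _ _ _ _ _)
    exact hmass _
  have hnum : (∑ fT ∈ golfInit n nb nt, ∑ cs : Fin nb → Bool,
      golfWeight p (List.ofFn ⇑fT.1) (List.ofFn cs) fT.2 *
        if golfRun (List.ofFn ⇑fT.1) (List.ofFn cs) fT.2 = X ∧ X ⊆ fT.2 ∧
          ∀ i : Fin (nt - nb),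
            (blockSet X i.val ∩ Finset.univ.map fT.1).card = b i ∧
              (blockSet X i.val ∩ fT.2).card = b i
        then (1 : ℝ) else 0) =
      ∑ fT ∈ cycleInit idx nb b,
        runExp (permProb p (cutPerm hcut)) (permStep (cutPerm hcut))
          (fun T => if T = univ.image x then 1 else 0) (List.ofFn fT.1) fT.2 := by
    have h1 : ∑ fT ∈ cycleInit idx nb b,
        runExp (permProb p (cutPerm hcut)) (permStep (cutPerm hcut))
          (fun T => if T = univ.image x then 1 else 0) (List.ofFn fT.1) fT.2 =
        ∑ fT ∈ (cycleInit idx nb b).filter fun fT => univ.image x ⊆ fT.2,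
          runExp (permProb p (cutPerm hcut)) (permStep (cutPerm hcut))
            (fun T => if T = univ.image x then 1 else 0) (List.ofFn fT.1) fT.2 := by
      rw [Finset.sum_filter]
      refine Finset.sum_congr rfl fun fT _ => ?_
      split_ifs with h
      · rfl
      · exact runExp_eq_zero _ _ (permStep_subset _) _ _ _ h
    rw [h1, ← hevent, Finset.sum_filter]
    refine Finset.sum_congr rfl fun fT hfT => ?_
    split_ifs with h
    · have hfT' : ∀ v ∈ List.ofFn fT.1, v ∉ fT.2 := by
        intro v hv
        obtain ⟨i, rfl⟩ := (List.mem_ofFn' _ _).1 hv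
        exact (Finset.mem_filter.1 hfT).2.2 i
      rw [← runExp_golf_eq_cutPerm hcut p _ _ hfT', ← sum_choices p _ nb _ List.length_ofFn]
      refine Finset.sum_congr rfl fun cs _ => ?_
      rw [himg]
      exact congrArg _ (if_congr (and_iff_left h) rfl rfl)
    · refine Finset.sum_eq_zero fun cs _ => ?_
      rw [if_neg fun h' => h h'.2, mul_zero]
  have hcycle := cycle_golf p (cutPerm hcut) idx (idx_eq_iff_sameCycle hcut) x hcut.idx_mark nb b
  have hcard : ((golfInit n nb nt).card : ℝ) ≠ 0 := by
    rw [Nat.cast_ne_zero, Finset.card_ne_zero]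
    rw [← hevent] at hne
    exact hne.mono (Finset.filter_subset _ _)
  have hE : (((cycleInit idx nb b).filter fun fT => univ.image x ⊆ fT.2).card : ℝ) ≠ 0 := by
    rw [Nat.cast_ne_zero, Finset.card_ne_zero]
    exact hne
  have hprod : ∏ i, ((b i : ℝ) + 1) ≠ 0 := Finset.prod_ne_zero_iff.2 fun i _ => by positivity
  rw [golfExp, golfExp, hden, hnum, div_div_div_cancel_right₀ hcard, Finset.prod_div_distrib,
    Finset.prod_const_one, div_eq_div_iff hE hprod, hcycle, one_mul]
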